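/- Let Ω = ℝ × (0,π) ⊆ ℝ² and let I denote the canonical embedding W_0^{1,2}(Ω) ↪ L²(Ω). Then I is maximally noncompact and β(I) = ‖I‖ = 1/√2. -/

import Mathlib

open MeasureTheory ENNReal Set Filter Topology

noncomputable section

/-- The `i`-th partial derivative of `u : ℝⁿ → ℝ`. -/
def pder {n : ℕ} (i : Fin n) (u : (Fin n → ℝ) → ℝ) (x : Fin n → ℝ) : ℝ :=
  fderiv ℝ u x (Pi.single i 1)

/-- `u` is a smooth function compactly supported in the open set `D`. -/
def IsTestFun {n : ℕ} (D : Set (Fin n → ℝ)) (u : (Fin n → ℝ) → ℝ) : Prop :=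
  ContDiff ℝ (⊤ : ℕ∞) u ∧ HasCompactSupport u ∧ tsupport u ⊆ D

/-- The strip-like domain `ℝᵏ × ∏_{i ≥ k} (aᵢ, bᵢ)`, realized as a subset of `ℝⁿ`:
the coordinates `i < k` are free, the coordinates `i ≥ k` are constrained to `(aᵢ, bᵢ)`. -/
def stripDomain (n k : ℕ) (a b : Fin n → ℝ) : Set (Fin n → ℝ) :=
  {x | ∀ i : Fin n, k ≤ (i : ℕ) → x i ∈ Set.Ioo (a i) (b i)}

/-- The ambient space `V = L^p(ℝⁿ; ℓ^p(ℝ^{n+1}))`, in which the Sobolev space `W^{1,p}_0`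
is realized as the closure of the set of "jets" `(u, ∇u)` of test functions. -/
abbrev Vsp (n : ℕ) (p : ℝ≥0∞) [Fact (1 ≤ p)] :=
  Lp (PiLp p (fun _ : Fin (n + 1) => ℝ)) p (volume : Measure (Fin n → ℝ))

/-- The "jet" `(u, ∂₁u, …, ∂ₙu)` of a function, valued in `ℓ^p(ℝ^{n+1})`. -/
def jet {n : ℕ} (p : ℝ≥0∞) (u : (Fin n → ℝ) → ℝ) (x : Fin n → ℝ) :
    PiLp p (fun _ : Fin (n + 1) => ℝ) :=
  (WithLp.equiv p (∀ _ : Fin (n + 1), ℝ)).symm (Fin.cons (u x) (fun i => pder i u x))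

/-- `W^{1,p}_0(D)` realized as a closed subspace of `V`:
the closure of the subspace of jets of test functions supported in `D`.
The (subspace) norm of the jet of `u` is exactly
`(‖u‖_p^p + ‖ |∇u|_{ℓ^p} ‖_p^p)^{1/p}`, i.e., the `W^{1,p}`-norm of `u`. -/
def W0sub {n : ℕ} (p : ℝ≥0∞) [Fact (1 ≤ p)] (D : Set (Fin n → ℝ)) : Submodule ℝ (Vsp n p) :=
  (Submodule.span ℝ {f : Vsp n p | ∃ u : (Fin n → ℝ) → ℝ, IsTestFun D u ∧
    (f : (Fin n → ℝ) → PiLp p (fun _ : Fin (n + 1) => ℝ)) =ᵐ[volume] jet p u}).topologicalClosure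

instance W0sub.completeSpace {n : ℕ} (p : ℝ≥0∞) [Fact (1 ≤ p)] (D : Set (Fin n → ℝ)) :
    CompleteSpace (W0sub (n := n) p D) :=
  (Submodule.isClosed_topologicalClosure _).completeSpace_coe

/-- Projection of a jet onto its zeroth (function) component. -/
def proj0 (n : ℕ) (p : ℝ≥0∞) [Fact (1 ≤ p)] : PiLp p (fun _ : Fin (n + 1) => ℝ) →L[ℝ] ℝ :=
  (ContinuousLinearMap.proj (0 : Fin (n + 1))).comp
    (PiLp.continuousLinearEquiv p ℝ (fun _ : Fin (n + 1) => ℝ)).toContinuousLinearMap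

/-- Projection of a jet onto its gradient components, valued in `ℓ^p(ℝⁿ)`. -/
def projGrad (n : ℕ) (p : ℝ≥0∞) [Fact (1 ≤ p)] :
    PiLp p (fun _ : Fin (n + 1) => ℝ) →L[ℝ] PiLp p (fun _ : Fin n => ℝ) :=
  ((PiLp.continuousLinearEquiv p ℝ (fun _ : Fin n => ℝ)).symm.toContinuousLinearMap).comp
    ((ContinuousLinearMap.pi fun i : Fin n => ContinuousLinearMap.proj (R := ℝ) i.succ).comp
      (PiLp.continuousLinearEquiv p ℝ (fun _ : Fin (n + 1) => ℝ)).toContinuousLinearMap)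

/-- The canonical Sobolev embedding `I : W^{1,p}_0(D) → L^p(D)` (as a map into `L^p(ℝⁿ)`;
all functions in `W^{1,p}_0(D)` vanish a.e. outside `D`). -/
def SobolevEmb {n : ℕ} (p : ℝ≥0∞) [Fact (1 ≤ p)] (D : Set (Fin n → ℝ)) :
    W0sub (n := n) p D →L[ℝ] Lp ℝ p (volume : Measure (Fin n → ℝ)) :=
  ((proj0 n p).compLpL p volume).comp (W0sub p D).subtypeL

/-- The gradient map `W^{1,p}_0(D) → L^p(D; ℓ^p(ℝⁿ))`, `u ↦ ∇u`. -/
def SobolevGrad {n : ℕ} (p : ℝ≥0∞) [Fact (1 ≤ p)] (D : Set (Fin n → ℝ)) :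
    W0sub (n := n) p D →L[ℝ] Lp (PiLp p (fun _ : Fin n => ℝ)) p (volume : Measure (Fin n → ℝ)) :=
  ((projGrad n p).compLpL p volume).comp (W0sub p D).subtypeL

/-- `π_p = 2 ∫₀¹ (1 - sᵖ)^{-1/p} ds`. -/
def piP (p : ℝ) : ℝ := 2 * ∫ s in (0 : ℝ)..1, (1 - s ^ p) ^ (-1 / p)

/-- The inverse of `t ↦ ∫₀ᵗ (1 - sᵖ)^{-1/p} ds` on `[0,1]`; this is `sin_p` on `[0, π_p/2]`. -/
def sinpHalf (p : ℝ) : ℝ → ℝ :=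
  Function.invFunOn (fun t : ℝ => ∫ s in (0 : ℝ)..t, (1 - s ^ p) ^ (-1 / p)) (Set.Icc 0 1)

/-- `sin_p` on `[0, π_p]`, by reflection around `π_p/2`. -/
def sinpBase (p t : ℝ) : ℝ :=
  if t ≤ piP p / 2 then sinpHalf p t else sinpHalf p (piP p - t)

/-- `sin_p` on `[-π_p, π_p]`, by odd reflection. -/
def sinpSym (p t : ℝ) : ℝ := if 0 ≤ t then sinpBase p t else -sinpBase p (-t)

/-- The generalized sine function `sin_p`, extended `2π_p`-periodically to all of `ℝ`. -/
def sinp (p t : ℝ) : ℝ :=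
  sinpSym p (t - 2 * piP p * ⌊(t + piP p) / (2 * piP p)⌋)

/-- The generalized cosine function `cos_p = (sin_p)'`. -/
def cosp (p : ℝ) : ℝ → ℝ := deriv (sinp p)

/-- The `m`-th entropy number of a bounded linear operator: the infimum of all `ε > 0` such
that the image of the closed unit ball can be covered by `2^{m-1}` balls of radius `ε`. -/
def entropyNumber {X Y : Type*} [NormedAddCommGroup X] [NormedSpace ℝ X]
    [NormedAddCommGroup Y] [NormedSpace ℝ Y] (m : ℕ) (T : X →L[ℝ] Y) : ℝ :=
  sInf {ε : ℝ | 0 < ε ∧ ∃ c : Fin (2 ^ (m - 1)) → Y,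
    ∀ x : X, ‖x‖ ≤ 1 → ∃ j, ‖T x - c j‖ ≤ ε}

end

/-- A finite cover of the image of the unit ball by balls of radius `ε` forces `ρ ≤ ε` as soon as
the image contains an orthogonal sequence of vectors of norm `ρ`. -/
theorem le_radius_of_finite_cover_of_orthonormal {X Y : Type*} [NormedAddCommGroup X]
    [NormedSpace ℝ X] [NormedAddCommGroup Y] [InnerProductSpace ℝ Y] {ι : Type*} [Finite ι]
    (T : X →L[ℝ] Y) {ρ ε : ℝ} (hρ : 0 < ρ) (x : ℕ → X)
    (hx : ∀ j, ‖x j‖ ≤ 1) (horth : Orthonormal ℝ (fun j => ρ⁻¹ • T (x j)))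
    (c : ι → Y) (hε : 0 < ε) (hc : ∀ x : X, ‖x‖ ≤ 1 → ∃ j, ‖T x - c j‖ ≤ ε) : ρ ≤ ε := by
  by_contra! hlt
  have hlim : ∀ i, Tendsto (fun j => inner ℝ (ρ⁻¹ • T (x j)) (c i)) atTop (𝓝 0) := by
    intro i
    have h := (horth.inner_products_summable (c i)).tendsto_atTop_zero
    have h2 := h.sqrt
    simp only [Real.sqrt_zero, Real.sqrt_sq_eq_abs, Real.norm_eq_abs, abs_abs] at h2
    exact (tendsto_zero_iff_abs_tendsto_zero _).2 h2
  have hpos : 0 < (ρ ^ 2 - ε ^ 2) / (2 * ρ) := by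
    apply div_pos _ (by positivity)
    nlinarith
  have hev : ∀ᶠ j in atTop, ∀ i, inner ℝ (ρ⁻¹ • T (x j)) (c i) < (ρ ^ 2 - ε ^ 2) / (2 * ρ) :=
    eventually_all.2 fun i => (hlim i).eventually (gt_mem_nhds hpos)
  obtain ⟨j, hj⟩ := hev.exists
  obtain ⟨i, hi⟩ := hc (x j) (hx j)
  have h1 : ‖T (x j)‖ = ρ := by
    have := horth.1 j
    rw [norm_smul, norm_inv, Real.norm_of_nonneg hρ.le] at this
    field_simp at this
    exact this
  have h2 := hj i
  rw [real_inner_smul_left, lt_div_iff₀ (by positivity)] at h2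
  have h3 : inner ℝ (T (x j)) (c i) * 2 < ρ ^ 2 - ε ^ 2 := by
    calc _ = ρ⁻¹ * inner ℝ (T (x j)) (c i) * (2 * ρ) := by field_simp
      _ < _ := h2
  have h4 := norm_sub_sq_real (T (x j)) (c i)
  rw [h1] at h4
  nlinarith [norm_nonneg (T (x j) - c i), sq_nonneg ‖c i‖]

section TestFunctions

variable {n : ℕ} {D : Set (Fin n → ℝ)} {u v : (Fin n → ℝ) → ℝ}

theorem IsTestFun.differentiable (hu : IsTestFun D u) : Differentiable ℝ u :=
  hu.1.differentiable (by simp)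

theorem IsTestFun.continuous_pder (hu : IsTestFun D u) (i : Fin n) : Continuous (pder i u) :=
  (hu.1.continuous_fderiv (by simp)).clm_apply continuous_const

theorem IsTestFun.hasCompactSupport_pder (hu : IsTestFun D u) (i : Fin n) :
    HasCompactSupport (pder i u) :=
  hu.2.1.fderiv_apply ℝ _

theorem IsTestFun.add (hu : IsTestFun D u) (hv : IsTestFun D v) :
    IsTestFun D (fun x => u x + v x) :=
  ⟨hu.1.add hv.1, hu.2.1.add hv.2.1,
    (tsupport_add u v).trans (union_subset hu.2.2 hv.2.2)⟩

theorem IsTestFun.const_smul (hu : IsTestFun D u) (a : ℝ) : IsTestFun D (fun x => a * u x) :=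
  ⟨contDiff_const.mul hu.1, hu.2.1.mul_left,
    (tsupport_mul_subset_right (f := fun _ => a)).trans hu.2.2⟩

theorem isTestFun_zero : IsTestFun D (fun _ => 0) :=
  ⟨contDiff_const, HasCompactSupport.zero, by simp [tsupport]⟩

theorem jet_zero (p : ℝ≥0∞) : jet (n := n) p (fun _ => 0) = 0 := by
  funext x
  ext j
  refine Fin.cases ?_ (fun i => ?_) j <;> simp [jet, pder]

theorem jet_add (p : ℝ≥0∞) (hu : Differentiable ℝ u) (hv : Differentiable ℝ v) :
    jet p (fun x => u x + v x) = jet p u + jet p v := by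
  funext x
  ext j
  refine Fin.cases ?_ (fun i => ?_) j
  · simp [jet]
  · simp [jet, pder, fderiv_fun_add (hu x) (hv x)]

theorem jet_const_mul (p : ℝ≥0∞) (hu : Differentiable ℝ u) (a : ℝ) :
    jet p (fun x => a * u x) = a • jet p u := by
  funext x
  ext j
  refine Fin.cases ?_ (fun i => ?_) j
  · simp [jet]
  · simp [jet, pder, fderiv_const_mul (hu x)]

theorem IsTestFun.memLp_jet (hu : IsTestFun D u) (p : ℝ≥0∞) [Fact (1 ≤ p)] :
    MemLp (jet p u) p (volume : Measure (Fin n → ℝ)) := by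
  apply Continuous.memLp_of_hasCompactSupport
  · apply (PiLp.continuous_toLp p _).comp
    refine continuous_pi fun j => ?_
    refine Fin.cases ?_ (fun i => ?_) j
    · simpa using hu.1.continuous
    · simpa using hu.continuous_pder i
  · refine HasCompactSupport.intro hu.2.1 fun x hx => ?_
    ext j
    refine Fin.cases ?_ (fun i => ?_) j
    · simpa [jet] using image_eq_zero_of_notMem_tsupport hx
    · have : fderiv ℝ u x = 0 := image_eq_zero_of_notMem_tsupport
        (fun h => hx (tsupport_fderiv_subset ℝ h))
      simp [jet, pder, this]

/-- Every element of the span of the jets of test functions is the jet of a test function. -/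
theorem exists_isTestFun_of_mem_span (p : ℝ≥0∞) [Fact (1 ≤ p)] {f : Vsp n p}
    (hf : f ∈ Submodule.span ℝ {f : Vsp n p | ∃ u : (Fin n → ℝ) → ℝ, IsTestFun D u ∧
      (f : (Fin n → ℝ) → PiLp p (fun _ : Fin (n + 1) => ℝ)) =ᵐ[volume] jet p u}) :
    ∃ u : (Fin n → ℝ) → ℝ, IsTestFun D u ∧
      (f : (Fin n → ℝ) → PiLp p (fun _ : Fin (n + 1) => ℝ)) =ᵐ[volume] jet p u := by
  induction hf using Submodule.span_induction with
  | mem f hf => exact hf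
  | zero => exact ⟨_, isTestFun_zero, by rw [jet_zero]; exact Lp.coeFn_zero _ _ _⟩
  | add f g _ _ hf hg =>
    obtain ⟨u, hu, hfu⟩ := hf
    obtain ⟨v, hv, hgv⟩ := hg
    refine ⟨_, hu.add hv, ?_⟩
    rw [jet_add p hu.differentiable hv.differentiable]
    exact (Lp.coeFn_add f g).trans (hfu.add hgv)
  | smul a f _ hf =>
    obtain ⟨u, hu, hfu⟩ := hf
    refine ⟨_, hu.const_smul a, ?_⟩
    rw [jet_const_mul p hu.differentiable]
    exact (Lp.coeFn_smul a f).trans (hfu.const_smul a)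

theorem inner_of_ae_eq_jet {f g : Vsp n 2}
    (hf : (f : (Fin n → ℝ) → PiLp 2 (fun _ : Fin (n + 1) => ℝ)) =ᵐ[volume] jet 2 u)
    (hg : (g : (Fin n → ℝ) → PiLp 2 (fun _ : Fin (n + 1) => ℝ)) =ᵐ[volume] jet 2 v) :
    inner ℝ ((proj0 n 2).compLpL 2 volume f) ((proj0 n 2).compLpL 2 volume g)
      = ∫ x, u x * v x := by
  rw [L2.inner_def]
  apply integral_congr_ae
  filter_upwards [hf, hg, (proj0 n 2).coeFn_compLpL f, (proj0 n 2).coeFn_compLpL g]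
    with x h1 h2 h3 h4
  rw [h3, h4, h1, h2]
  simp [proj0, jet, mul_comm]

theorem norm_sq_of_ae_eq_jet {f : Vsp n 2} (hu : IsTestFun D u)
    (hf : (f : (Fin n → ℝ) → PiLp 2 (fun _ : Fin (n + 1) => ℝ)) =ᵐ[volume] jet 2 u) :
    ‖f‖ ^ 2 = (∫ x, u x ^ 2) + ∑ i, ∫ x, pder i u x ^ 2 := by
  have h1 : Integrable (fun x => u x ^ 2) := by
    apply (hu.1.continuous.pow 2).integrable_of_hasCompactSupport
    simpa only [sq] using hu.2.1.mul_left
  have h2 : ∀ i, Integrable (fun x => pder i u x ^ 2) := by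
    intro i
    apply ((hu.continuous_pder i).pow 2).integrable_of_hasCompactSupport
    simpa only [sq] using (hu.hasCompactSupport_pder i).mul_left
  rw [← integral_finsetSum _ (fun i _ => h2 i), ← integral_add h1
    (integrable_finsetSum _ fun i _ => h2 i), ← real_inner_self_eq_norm_sq, L2.inner_def]
  apply integral_congr_ae
  filter_upwards [hf] with x h
  rw [h]
  rw [real_inner_self_eq_norm_sq, PiLp.norm_sq_eq_of_L2, Fin.sum_univ_succ]
  simp [jet]

end TestFunctions

section Poincare

theorem integral_fderiv_eq_zero_of_hasCompactSupport {n : ℕ} {w : (Fin n → ℝ) → ℝ}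
    (hw : ContDiff ℝ 1 w) (hc : HasCompactSupport w) (v : Fin n → ℝ) :
    ∫ x, fderiv ℝ w x v = 0 := by
  have hi : Integrable (fun x => fderiv ℝ w x v) :=
    ((hw.continuous_fderiv (by simp)).clm_apply
      continuous_const).integrable_of_hasCompactSupport (hc.fderiv_apply ℝ _)
  have h := integral_mul_fderiv_eq_neg_fderiv_mul_of_integrable (μ := volume)
    (f := fun _ : Fin n → ℝ => (1 : ℝ)) (g := w) (v := v) (by simp) (by simpa using hi)
    (by simpa using hw.continuous.integrable_of_hasCompactSupport hc)
    (fun x _ => differentiableAt_const _) (fun x _ => hw.differentiable (by simp) x)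
  simpa using h

/-- The Poincaré inequality in the direction in which the strip is bounded, proved by means of
the factorization of Jacobi: up to a divergence, the difference of the two integrands is the square
of `∂₂u - u cot`. -/
theorem integral_sq_le_integral_pder_sq {u : (Fin 2 → ℝ) → ℝ}
    (hu : IsTestFun (stripDomain 2 1 (fun _ => 0) (fun _ => Real.pi)) u) :
    ∫ x, u x ^ 2 ≤ ∫ x, pder 1 u x ^ 2 := by
  set C : (Fin 2 → ℝ) → ℝ := fun x => Real.cos (x 1) / Real.sin (x 1) with hC
  have hsin : ∀ x ∈ tsupport u, Real.sin (x 1) ≠ 0 := fun x hx =>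
    (Real.sin_pos_of_mem_Ioo (hu.2.2 hx 1 (by simp))).ne'
  have hzero : ∀ x ∉ tsupport u, u =ᶠ[𝓝 x] 0 := fun x hx => notMem_tsupport_iff_eventuallyEq.1 hx
  have hg : ContDiff ℝ 1 (fun x => u x * C x) := by
    rw [contDiff_iff_contDiffAt]
    intro x
    by_cases hx : x ∈ tsupport u
    · refine (hu.1.contDiffAt.of_le (by exact_mod_cast le_top)).mul (ContDiffAt.div ?_ ?_ (hsin x hx))
      · exact (Real.contDiff_cos.comp (contDiff_apply ℝ ℝ (1 : Fin 2))).contDiffAt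
      · exact (Real.contDiff_sin.comp (contDiff_apply ℝ ℝ (1 : Fin 2))).contDiffAt
    · refine contDiffAt_const (c := (0 : ℝ)) |>.congr_of_eventuallyEq ?_
      filter_upwards [hzero x hx] with y hy
      simp [hy]
  have hw : ContDiff ℝ 1 (fun x => u x * (u x * C x)) :=
    (hu.1.of_le (by exact_mod_cast le_top)).mul hg
  have hwc : HasCompactSupport (fun x => u x * (u x * C x)) := hu.2.1.mul_right
  have hgc : HasCompactSupport (fun x => u x * C x) := hu.2.1.mul_right
  have hder : ∀ x, fderiv ℝ (fun x => u x * (u x * C x)) x (Pi.single 1 1)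
      = pder 1 u x ^ 2 - u x ^ 2 - (pder 1 u x - u x * C x) ^ 2 := by
    intro x
    by_cases hx : x ∈ tsupport u
    · have hs := hsin x hx
      have h1 : HasFDerivAt u (fderiv ℝ u x) x := (hu.differentiable x).hasFDerivAt
      have hcot : HasDerivAt (fun t => Real.cos t / Real.sin t)
          ((-Real.sin (x 1) * Real.sin (x 1) - Real.cos (x 1) * Real.cos (x 1))
            / Real.sin (x 1) ^ 2) (x 1) :=
        (Real.hasDerivAt_cos _).div (Real.hasDerivAt_sin _) hs
      have h2 := hcot.comp_hasFDerivAt x (hasFDerivAt_apply (𝕜 := ℝ) (1 : Fin 2) x)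
      have h3 : HasFDerivAt C _ x := h2
      have h4 := (h1.mul (h1.mul h3)).fderiv
      have h5 : (fun x => u x * (u x * C x)) = u * (u * C) := rfl
      rw [h5, h4]
      simp only [pder, _root_.add_apply, _root_.smul_apply,
        ContinuousLinearMap.proj_apply, Pi.single_eq_same, smul_eq_mul, hC, Pi.mul_apply]
      field_simp
      ring_nf
    · have h0 : u x = 0 := image_eq_zero_of_notMem_tsupport hx
      have hd : pder 1 u x = 0 := by
        simp [pder, (hzero x hx).fderiv_eq]
      have hd' : fderiv ℝ (fun x => u x * (u x * C x)) x = 0 := by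
        have : (fun x => u x * (u x * C x)) =ᶠ[𝓝 x] fun _ => 0 := by
          filter_upwards [hzero x hx] with y hy
          simp [hy]
        rw [this.fderiv_eq]
        simp
      rw [hd', hd, h0]
      simp
  have hint := integral_fderiv_eq_zero_of_hasCompactSupport hw hwc (Pi.single 1 1)
  have hi1 : Integrable (fun x => u x ^ 2) := by
    apply (hu.1.continuous.pow 2).integrable_of_hasCompactSupport
    simpa only [sq] using hu.2.1.mul_left
  have hi2 : Integrable (fun x => pder 1 u x ^ 2) := by
    apply ((hu.continuous_pder 1).pow 2).integrable_of_hasCompactSupport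
    simpa only [sq] using (hu.hasCompactSupport_pder 1).mul_left
  have hi3 : Integrable (fun x => (pder 1 u x - u x * C x) ^ 2) := by
    apply (((hu.continuous_pder 1).sub hg.continuous).pow 2).integrable_of_hasCompactSupport
    simpa only [sq] using ((hu.hasCompactSupport_pder 1).sub hgc).mul_left
  simp_rw [hder] at hint
  rw [integral_sub (f := fun x => pder 1 u x ^ 2 - u x ^ 2) (hi2.sub hi1) hi3,
    integral_sub hi2 hi1] at hint
  have : 0 ≤ ∫ x, (pder 1 u x - u x * C x) ^ 2 := integral_nonneg fun x => sq_nonneg _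
  linarith

theorem norm_sobolevEmb_strip_le :
    ‖SobolevEmb (2 : ℝ≥0∞) (stripDomain 2 1 (fun _ => 0) (fun _ => Real.pi))‖ ≤
      1 / Real.sqrt 2 := by
  refine ContinuousLinearMap.opNorm_le_bound _ (by positivity) fun f => ?_
  obtain ⟨f, hf⟩ := f
  change ‖(proj0 2 2).compLpL 2 volume f‖ ≤ 1 / Real.sqrt 2 * ‖f‖
  rw [W0sub, ← SetLike.mem_coe, Submodule.topologicalClosure_coe] at hf
  refine closure_minimal (t := {f : Vsp 2 2 | ‖(proj0 2 2).compLpL 2 volume f‖ ≤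
    1 / Real.sqrt 2 * ‖f‖}) ?_ ?_ hf
  · intro f hf
    obtain ⟨u, hu, hfu⟩ := exists_isTestFun_of_mem_span 2 hf
    have h1 := norm_sq_of_ae_eq_jet hu hfu
    have h2 := inner_of_ae_eq_jet hfu hfu
    rw [real_inner_self_eq_norm_sq] at h2
    simp_rw [← sq] at h2
    rw [Fin.sum_univ_two] at h1
    have h3 : 0 ≤ ∫ x, pder 0 u x ^ 2 := integral_nonneg fun x => sq_nonneg _
    have h4 := integral_sq_le_integral_pder_sq hu
    refine (sq_le_sq₀ (norm_nonneg _) (by positivity)).1 ?_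
    rw [mul_pow, div_pow, Real.sq_sqrt (by norm_num)]
    linarith
  · exact isClosed_le (by fun_prop) (by fun_prop)

end Poincare

section OneDimensional

/-- Wide bump functions have an arbitrarily small Dirichlet quotient on the line. -/
theorem exists_bump_integral_deriv_sq_le {δ : ℝ} (hδ : 0 < δ) :
    ∃ φ : ℝ → ℝ, ContDiff ℝ (⊤ : ℕ∞) φ ∧ HasCompactSupport φ ∧ 0 < ∫ x, φ x ^ 2 ∧
      ∫ x, deriv φ x ^ 2 ≤ δ * ∫ x, φ x ^ 2 := by
  let f : ContDiffBump (0 : ℝ) := ⟨1, 2, one_pos, one_lt_two⟩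
  have hf : ContDiff ℝ (⊤ : ℕ∞) f := f.contDiff
  have hpos : 0 < ∫ x, f x ^ 2 := by
    refine (f.continuous.pow 2).integral_pos_of_hasCompactSupport_nonneg_nonzero
      (x := 0) ?_ (fun x => sq_nonneg _) ?_
    · simp_rw [sq]
      exact f.hasCompactSupport.mul_left
    · simp [f.one_of_mem_closedBall (Metric.mem_closedBall_self f.rIn_pos.le)]
  set A := ∫ x, f x ^ 2 with hA
  set B := ∫ x, deriv f x ^ 2 with hB
  obtain ⟨L, hL1, hL2⟩ : ∃ L : ℝ, 1 ≤ L ∧ B / (δ * A) ≤ L :=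
    ⟨max 1 (B / (δ * A)), le_max_left _ _, le_max_right _ _⟩
  have hL0 : 0 < L := by linarith
  have hd : ∀ x, deriv (fun x => f (x / L)) x = deriv f (x / L) / L := by
    intro x
    have h := ((hf.differentiable (by simp)) (x / L)).hasDerivAt.comp x
      ((hasDerivAt_id x).div_const L)
    rw [show (fun x => f (x / L)) = f ∘ fun x => id x / L from rfl, h.deriv]
    simp [div_eq_mul_inv]
  have h1 : ∫ x, f (x / L) ^ 2 = L * A := by
    rw [Measure.integral_comp_div (fun x => f x ^ 2), abs_of_pos hL0, smul_eq_mul]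
  have h2 : ∫ x, (deriv f (x / L) / L) ^ 2 = B / L := by
    simp_rw [div_pow]
    rw [integral_div, Measure.integral_comp_div (fun x => deriv f x ^ 2), abs_of_pos hL0,
      smul_eq_mul, ← hB]
    field_simp
  refine ⟨fun x => f (x / L), hf.comp (contDiff_id.div_const L), ?_, ?_, ?_⟩
  · simpa only [div_eq_mul_inv] using! f.hasCompactSupport.comp_homeomorph
      (Homeomorph.mulRight₀ L⁻¹ (inv_ne_zero hL0.ne'))
  · rw [h1]
    positivity
  · simp_rw [hd]
    rw [h1, h2, div_le_iff₀ hL0]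
    rw [div_le_iff₀ (by positivity)] at hL2
    have : L * (δ * A) * 1 ≤ L * (δ * A) * L := mul_le_mul_of_nonneg_left hL1 (by positivity)
    linarith

/-- A smooth, nondecreasing, `1`-Lipschitz approximation of `t ↦ max t 0` vanishing near `0`. -/
theorem exists_smooth_truncation {ε : ℝ} (hε : 0 < ε) :
    ∃ F : ℝ → ℝ, ContDiff ℝ (⊤ : ℕ∞) F ∧ (∀ t, 0 ≤ deriv F t ∧ deriv F t ≤ 1) ∧
      (∀ t ≤ ε, F t = 0) ∧ (∀ t, 0 ≤ F t) ∧ ∀ t, t - 2 * ε ≤ F t := by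
  set g : ℝ → ℝ := fun s => Real.smoothTransition ((s - ε) / ε) with hg
  have hgs : ContDiff ℝ (⊤ : ℕ∞) g :=
    Real.smoothTransition.contDiff.comp ((contDiff_id.sub contDiff_const).div_const _)
  have hgc := hgs.continuous
  have hgi : ∀ a b, IntervalIntegrable g volume a b := fun a b => hgc.intervalIntegrable a b
  have hF : ∀ t, HasDerivAt (fun t => ∫ s in ε..t, g s) (g t) t := fun t =>
    intervalIntegral.integral_hasDerivAt_right (hgi _ _)
      (hgc.stronglyMeasurableAtFilter _ _) hgc.continuousAt
  have hz : ∀ t ≤ ε, ∫ s in ε..t, g s = 0 := by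
    intro t ht
    rw [intervalIntegral.integral_congr (g := fun _ => (0 : ℝ))]
    · simp
    · intro s hs
      rw [uIcc_of_ge ht] at hs
      exact Real.smoothTransition.zero_of_nonpos
        (div_nonpos_of_nonpos_of_nonneg (by linarith [hs.2]) hε.le)
  have hn : ∀ t, 0 ≤ ∫ s in ε..t, g s := by
    intro t
    rcases le_total t ε with ht | ht
    · rw [hz t ht]
    · exact intervalIntegral.integral_nonneg ht fun s _ => Real.smoothTransition.nonneg _
  refine ⟨fun t => ∫ s in ε..t, g s, ?_, ?_, hz, hn, ?_⟩
  · rw [contDiff_infty_iff_deriv]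
    refine ⟨fun t => (hF t).differentiableAt, ?_⟩
    rwa [show deriv (fun t => ∫ s in ε..t, g s) = g from funext fun t => (hF t).deriv]
  · intro t
    rw [(hF t).deriv]
    exact ⟨Real.smoothTransition.nonneg _, Real.smoothTransition.le_one _⟩
  · intro t
    rcases le_total t (2 * ε) with ht | ht
    · linarith [hn t]
    · beta_reduce
      rw [← intervalIntegral.integral_add_adjacent_intervals (hgi ε (2 * ε)) (hgi (2 * ε) t)]
      have h1 := hn (2 * ε)
      have h2 : ∫ s in (2 * ε)..t, g s = ∫ s in (2 * ε)..t, (1 : ℝ) := by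
        apply intervalIntegral.integral_congr
        intro s hs
        rw [uIcc_of_le ht] at hs
        exact Real.smoothTransition.one_of_one_le ((one_le_div hε).2 (by linarith [hs.1]))
      rw [h2]
      simp only [intervalIntegral.integral_const, smul_eq_mul, mul_one]
      linarith

/-- Truncated sines almost attain the first Dirichlet eigenvalue of `(0, π)`. -/
theorem exists_truncated_sin_integral_deriv_sq_le {δ : ℝ} (hδ : 0 < δ) :
    ∃ ψ : ℝ → ℝ, ContDiff ℝ (⊤ : ℕ∞) ψ ∧ HasCompactSupport ψ ∧ tsupport ψ ⊆ Ioo 0 Real.pi ∧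
      0 < ∫ x, ψ x ^ 2 ∧ ∫ x, deriv ψ x ^ 2 ≤ (1 + δ) * ∫ x, ψ x ^ 2 := by
  set ε : ℝ := δ / (8 * (1 + δ)) with hεdef
  have hε : 0 < ε := by positivity
  obtain ⟨F, hF, hF', hF0, hFn, hFl⟩ := exists_smooth_truncation hε
  have hG : ContDiff ℝ (⊤ : ℕ∞) (fun y => F (Real.sin y)) := hF.comp Real.contDiff_sin
  set ψ : ℝ → ℝ := (Ioo 0 Real.pi).indicator (fun y => F (Real.sin y)) with hψ
  have hin : ∀ y ∈ Ioo 0 Real.pi, ψ =ᶠ[𝓝 y] fun y => F (Real.sin y) := by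
    intro y hy
    filter_upwards [isOpen_Ioo.mem_nhds hy] with z hz
    simp [hψ, hz]
  have hout : ∀ y ∉ Ioo 0 Real.pi, ψ =ᶠ[𝓝 y] fun _ => 0 := by
    intro y hy
    by_cases hy2 : y ∈ Icc 0 Real.pi
    · have hs : Real.sin y = 0 := by
        rcases eq_or_lt_of_le hy2.1 with h | h
        · rw [← h, Real.sin_zero]
        · rcases eq_or_lt_of_le hy2.2 with h' | h'
          · rw [h', Real.sin_pi]
          · exact absurd ⟨h, h'⟩ hy
      have : ∀ᶠ z in 𝓝 y, Real.sin z < ε :=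
        Real.continuous_sin.continuousAt.eventually (gt_mem_nhds (by rw [hs]; exact hε))
      filter_upwards [this] with z hz
      simp [hψ, indicator_apply, hF0 _ hz.le]
    · filter_upwards [isClosed_Icc.isOpen_compl.mem_nhds hy2] with z hz
      exact indicator_of_notMem (fun h => hz (Ioo_subset_Icc_self h)) _
  have hsmooth : ContDiff ℝ (⊤ : ℕ∞) ψ := by
    rw [contDiff_iff_contDiffAt]
    intro y
    by_cases hy : y ∈ Ioo 0 Real.pi
    · exact hG.contDiffAt.congr_of_eventuallyEq (hin y hy)
    · exact contDiffAt_const.congr_of_eventuallyEq (hout y hy)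
  have hsupp : tsupport ψ ⊆ Ioo 0 Real.pi := by
    intro y hy
    by_contra h
    exact notMem_tsupport_iff_eventuallyEq.2 (hout y h) hy
  have hcomp : HasCompactSupport ψ :=
    isCompact_Icc.of_isClosed_subset (isClosed_tsupport _) (hsupp.trans Ioo_subset_Icc_self)
  have hupper : ∫ x, deriv ψ x ^ 2 ≤ Real.pi / 2 := by
    calc ∫ x, deriv ψ x ^ 2 ≤ ∫ x, (Ioc 0 Real.pi).indicator (fun y => Real.cos y ^ 2) x := by
          apply integral_mono_of_nonneg
          · exact Eventually.of_forall fun x => sq_nonneg _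
          · rw [integrable_indicator_iff measurableSet_Ioc]
            exact ((Real.continuous_cos.pow 2).integrableOn_Icc).mono_set Ioc_subset_Icc_self
          · refine Eventually.of_forall fun y => ?_
            by_cases hy : y ∈ Ioo 0 Real.pi
            · have h := ((hF.differentiable (by simp)) (Real.sin y)).hasDerivAt.comp y
                (Real.hasDerivAt_sin y)
              have h' : deriv ψ y = deriv F (Real.sin y) * Real.cos y :=
                (hin y hy).deriv_eq.trans h.deriv
              simp only [h', indicator_of_mem (Ioo_subset_Ioc_self hy), mul_pow]
              obtain ⟨h0, h1⟩ := hF' (Real.sin y)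
              exact mul_le_of_le_one_left (sq_nonneg _) (pow_le_one₀ h0 h1)
            · have h' : deriv ψ y = 0 := (hout y hy).deriv_eq.trans (deriv_const _ _)
              simp only [h']
              rw [zero_pow two_ne_zero]
              exact indicator_nonneg (fun _ _ => sq_nonneg _) _
      _ = ∫ y in (0 : ℝ)..Real.pi, Real.cos y ^ 2 := by
          rw [integral_indicator measurableSet_Ioc,
            intervalIntegral.integral_of_le Real.pi_pos.le]
      _ = Real.pi / 2 := by
          rw [integral_cos_sq]
          simp
  have hlower : Real.pi / 2 - 4 * ε * Real.pi ≤ ∫ x, ψ x ^ 2 := by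
    calc Real.pi / 2 - 4 * ε * Real.pi
        = ∫ y in (0 : ℝ)..Real.pi, (Real.sin y ^ 2 - 4 * ε) := by
          rw [intervalIntegral.integral_sub (f := fun y => Real.sin y ^ 2)
            ((Real.continuous_sin.pow 2).intervalIntegrable _ _) (by simp), integral_sin_sq]
          simp
          ring
      _ ≤ ∫ y in (0 : ℝ)..Real.pi, F (Real.sin y) ^ 2 := by
          apply intervalIntegral.integral_mono_on Real.pi_pos.le
          · exact Continuous.intervalIntegrable (by fun_prop) _ _
          · exact (hG.continuous.pow 2).intervalIntegrable _ _
          · intro y hy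
            have h0 := Real.sin_nonneg_of_mem_Icc hy
            have h1 := Real.sin_le_one y
            have h2 := hFn (Real.sin y)
            have h3 := hFl (Real.sin y)
            rcases le_total (Real.sin y) (2 * ε) with h | h
            · nlinarith
            · nlinarith
      _ = ∫ x, (Ioo 0 Real.pi).indicator (fun y => F (Real.sin y) ^ 2) x := by
          rw [integral_indicator measurableSet_Ioo,
            intervalIntegral.integral_of_le Real.pi_pos.le, integral_Ioc_eq_integral_Ioo]
      _ = ∫ x, ψ x ^ 2 := by
          congr 1
          ext y
          simp only [hψ, indicator_apply]
          split_ifs <;> simp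
  have hε8 : (1 + δ) * (Real.pi / 2 - 4 * ε * Real.pi) = Real.pi / 2 := by
    rw [hεdef]
    field_simp
    ring
  have hmul := mul_le_mul_of_nonneg_left hlower (by positivity : 0 ≤ 1 + δ)
  refine ⟨ψ, hsmooth, hcomp, hsupp, ?_, by linarith⟩
  have : 0 < (1 + δ) * ∫ x, ψ x ^ 2 := by linarith [Real.pi_pos]
  exact pos_of_mul_pos_right this (by positivity)

end OneDimensional

section TensorProducts

theorem integral_mul_fin_two (a b : ℝ → ℝ) :
    ∫ x : Fin 2 → ℝ, a (x 0) * b (x 1) = (∫ t, a t) * ∫ t, b t := by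
  simpa using integral_fintype_prod_volume_eq_prod (ι := Fin 2) (f := ![a, b])

variable {φ ψ : ℝ → ℝ}

theorem isTestFun_strip_mul (hφ : ContDiff ℝ (⊤ : ℕ∞) φ) (hφc : HasCompactSupport φ)
    (hψ : ContDiff ℝ (⊤ : ℕ∞) ψ) (hψc : HasCompactSupport ψ) {a b : ℝ}
    (hψs : tsupport ψ ⊆ Ioo a b) :
    IsTestFun (stripDomain 2 1 (fun _ => a) (fun _ => b)) (fun x => φ (x 0) * ψ (x 1)) := by
  refine ⟨(hφ.comp (contDiff_apply ℝ ℝ (0 : Fin 2))).mul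
    (hψ.comp (contDiff_apply ℝ ℝ (1 : Fin 2))), ?_, ?_⟩
  · refine HasCompactSupport.intro (K := Set.pi univ ![tsupport φ, tsupport ψ])
      (isCompact_univ_pi ?_) ?_
    · intro i
      fin_cases i
      exacts [hφc, hψc]
    · intro x hx
      by_contra h
      refine hx fun i _ => ?_
      fin_cases i
      exacts [subset_tsupport _ (left_ne_zero_of_mul h),
        subset_tsupport _ (right_ne_zero_of_mul h)]
  · have hcl : IsClosed {x : Fin 2 → ℝ | x 1 ∈ tsupport ψ} :=
      (isClosed_tsupport ψ).preimage (continuous_apply 1)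
    have hsub : tsupport (fun x : Fin 2 → ℝ => φ (x 0) * ψ (x 1)) ⊆ {x | x 1 ∈ tsupport ψ} :=
      closure_minimal (fun x hx => subset_tsupport _ (right_ne_zero_of_mul hx)) hcl
    intro x hx i hi
    obtain rfl : i = 1 := by omega
    exact hψs (hsub hx)

theorem hasFDerivAt_mul_fin_two (hφ : Differentiable ℝ φ) (hψ : Differentiable ℝ ψ)
    (x : Fin 2 → ℝ) :
    HasFDerivAt (fun x : Fin 2 → ℝ => φ (x 0) * ψ (x 1))
      (φ (x 0) • deriv ψ (x 1) • ContinuousLinearMap.proj (R := ℝ) (φ := fun _ : Fin 2 => ℝ) 1 +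
        ψ (x 1) • deriv φ (x 0) • ContinuousLinearMap.proj (R := ℝ) (φ := fun _ : Fin 2 => ℝ) 0)
      x :=
  ((hφ (x 0)).hasDerivAt.comp_hasFDerivAt x (hasFDerivAt_apply (𝕜 := ℝ) (0 : Fin 2) x)).mul
    ((hψ (x 1)).hasDerivAt.comp_hasFDerivAt x (hasFDerivAt_apply (𝕜 := ℝ) (1 : Fin 2) x))

theorem pder_zero_mul_fin_two (hφ : Differentiable ℝ φ) (hψ : Differentiable ℝ ψ)
    (x : Fin 2 → ℝ) : pder 0 (fun x => φ (x 0) * ψ (x 1)) x = deriv φ (x 0) * ψ (x 1) := by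
  rw [pder, (hasFDerivAt_mul_fin_two hφ hψ x).fderiv]
  simp [mul_comm]

theorem pder_one_mul_fin_two (hφ : Differentiable ℝ φ) (hψ : Differentiable ℝ ψ)
    (x : Fin 2 → ℝ) : pder 1 (fun x => φ (x 0) * ψ (x 1)) x = φ (x 0) * deriv ψ (x 1) := by
  rw [pder, (hasFDerivAt_mul_fin_two hφ hψ x).fderiv]
  simp

end TensorProducts

/-- A compactly supported function has equally spaced translates with disjoint supports. -/
theorem exists_translates_mul_eq_zero {φ : ℝ → ℝ} (hφ : HasCompactSupport φ) :
    ∃ R : ℝ, ∀ j k : ℕ, j ≠ k → ∀ t, φ (t - j * R) * φ (t - k * R) = 0 := by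
  obtain ⟨K, hK⟩ := hφ.isCompact.isBounded.exists_norm_le
  refine ⟨2 * |K| + 1, fun j k hjk t => ?_⟩
  by_contra h
  have h1 := abs_le.1 ((hK _ (subset_tsupport _ (left_ne_zero_of_mul h))).trans (le_abs_self K))
  have h2 := abs_le.1 ((hK _ (subset_tsupport _ (right_ne_zero_of_mul h))).trans (le_abs_self K))
  have hK0 := abs_nonneg K
  rcases lt_or_gt_of_ne hjk with hlt | hlt
  · have : (j : ℝ) + 1 ≤ k := by exact_mod_cast hlt
    nlinarith
  · have : (k : ℝ) + 1 ≤ j := by exact_mod_cast hlt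
    nlinarith

/-- There is a sequence of test-function jets of equal norm, with orthogonal images under the
embedding, whose Rayleigh quotient is as close to `2` as desired. -/
theorem exists_orthogonal_sequence_strip {δ : ℝ} (hδ : 0 < δ) :
    ∃ (J : ℕ → W0sub 2 (stripDomain 2 1 (fun _ => 0) (fun _ => Real.pi))) (A B : ℝ),
      0 < B ∧ 0 < A ∧ A ≤ (2 + 2 * δ) * B ∧ (∀ j, ‖J j‖ ^ 2 = A) ∧
      ∀ j k, inner ℝ (SobolevEmb 2 _ (J j)) (SobolevEmb 2 _ (J k)) = if j = k then B else 0 := by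
  obtain ⟨φ, hφ, hφc, hφpos, hφle⟩ := exists_bump_integral_deriv_sq_le hδ
  obtain ⟨ψ, hψ, hψc, hψs, hψpos, hψle⟩ := exists_truncated_sin_integral_deriv_sq_le hδ
  obtain ⟨R, hR⟩ := exists_translates_mul_eq_zero hφc
  set Φ : ℕ → ℝ → ℝ := fun j t => φ (t - j * R) with hΦ
  have hΦs : ∀ j, ContDiff ℝ (⊤ : ℕ∞) (Φ j) := fun j => hφ.comp (contDiff_id.sub contDiff_const)
  have hΦc : ∀ j, HasCompactSupport (Φ j) := fun j =>
    hφc.comp_homeomorph (Homeomorph.subRight ((j : ℝ) * R))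
  have hΦd : ∀ j t, deriv (Φ j) t = deriv φ (t - j * R) := fun j t =>
    deriv_comp_sub_const φ ((j : ℝ) * R) t
  set u : ℕ → (Fin 2 → ℝ) → ℝ := fun j x => Φ j (x 0) * ψ (x 1) with hu
  have hut : ∀ j, IsTestFun (stripDomain 2 1 (fun _ => 0) (fun _ => Real.pi)) (u j) :=
    fun j => isTestFun_strip_mul (hΦs j) (hΦc j) hψ hψc hψs
  have hmem : ∀ j, ((hut j).memLp_jet 2).toLp _ ∈
      W0sub 2 (stripDomain 2 1 (fun _ => 0) (fun _ => Real.pi)) := fun j =>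
    Submodule.le_topologicalClosure _ (Submodule.subset_span ⟨u j, hut j, MemLp.coeFn_toLp _⟩)
  set a := ∫ t, φ t ^ 2 with ha
  set b := ∫ t, ψ t ^ 2 with hb
  set a' := ∫ t, deriv φ t ^ 2 with ha'
  set b' := ∫ t, deriv ψ t ^ 2 with hb'
  have ha0 : 0 ≤ a' := integral_nonneg fun x => sq_nonneg _
  have hb0 : 0 ≤ b' := integral_nonneg fun x => sq_nonneg _
  have hΦa : ∀ j, ∫ t, Φ j t ^ 2 = a := fun j =>
    integral_sub_right_eq_self (fun t => φ t ^ 2) ((j : ℝ) * R)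
  have hΦa' : ∀ j, ∫ t, deriv (Φ j) t ^ 2 = a' := fun j => by
    simp_rw [hΦd]
    exact integral_sub_right_eq_self (fun t => deriv φ t ^ 2) ((j : ℝ) * R)
  refine ⟨fun j => ⟨_, hmem j⟩, a * b + (a' * b + a * b'), a * b, by positivity, by positivity,
    ?_, ?_, ?_⟩
  · nlinarith [mul_le_mul_of_nonneg_right hφle hψpos.le,
      mul_le_mul_of_nonneg_left hψle hφpos.le]
  · intro j
    change ‖((hut j).memLp_jet 2).toLp _‖ ^ 2 = _
    rw [norm_sq_of_ae_eq_jet (hut j) (MemLp.coeFn_toLp _), Fin.sum_univ_two]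
    have hd1 := (hΦs j).differentiable (by simp)
    have hd2 := hψ.differentiable (by simp)
    simp_rw [hu, pder_zero_mul_fin_two hd1 hd2, pder_one_mul_fin_two hd1 hd2, mul_pow]
    rw [integral_mul_fin_two (fun t => Φ j t ^ 2) (fun t => ψ t ^ 2),
      integral_mul_fin_two (fun t => deriv (Φ j) t ^ 2) (fun t => ψ t ^ 2),
      integral_mul_fin_two (fun t => Φ j t ^ 2) (fun t => deriv ψ t ^ 2), hΦa, hΦa']
  · intro j k
    change inner ℝ ((proj0 2 2).compLpL 2 volume (((hut j).memLp_jet 2).toLp _))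
      ((proj0 2 2).compLpL 2 volume (((hut k).memLp_jet 2).toLp _)) = _
    rw [inner_of_ae_eq_jet (MemLp.coeFn_toLp _) (MemLp.coeFn_toLp _)]
    simp_rw [hu, mul_mul_mul_comm]
    rw [integral_mul_fin_two (fun t => Φ j t * Φ k t) (fun t => ψ t * ψ t)]
    split_ifs with h
    · subst h
      simp_rw [← sq]
      rw [hΦa]
    · simp_rw [hΦ, hR j k h]
      simp

theorem one_div_sqrt_two_le_of_finite_cover {ι : Type*} [Finite ι]
    (c : ι → Lp ℝ 2 (volume : Measure (Fin 2 → ℝ))) {ε : ℝ} (hε : 0 < ε)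
    (hc : ∀ x : W0sub 2 (stripDomain 2 1 (fun _ => 0) (fun _ => Real.pi)), ‖x‖ ≤ 1 →
      ∃ j, ‖SobolevEmb 2 _ x - c j‖ ≤ ε) : 1 / Real.sqrt 2 ≤ ε := by
  have key : ∀ δ > 0, 1 ≤ (2 + 2 * δ) * ε ^ 2 := by
    intro δ hδ
    obtain ⟨J, A, B, hB, hA, hAB, hJ, hin⟩ := exists_orthogonal_sequence_strip hδ
    have hJn : ∀ j, ‖J j‖ = Real.sqrt A := fun j => by
      rw [← hJ j, Real.sqrt_sq (norm_nonneg _)]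
    have hsA : 0 < Real.sqrt A := Real.sqrt_pos.2 hA
    have hsB : 0 < Real.sqrt B := Real.sqrt_pos.2 hB
    have h := le_radius_of_finite_cover_of_orthonormal
      (SobolevEmb 2 (stripDomain 2 1 (fun _ => 0) (fun _ => Real.pi)))
      (ρ := Real.sqrt B / Real.sqrt A) (by positivity) (fun j => (Real.sqrt A)⁻¹ • J j)
      (fun j => by
        rw [norm_smul, hJn, norm_inv, Real.norm_of_nonneg hsA.le, inv_mul_cancel₀ hsA.ne'])
      (by
        rw [orthonormal_iff_ite]
        intro j k
        rw [map_smul, map_smul, smul_smul, smul_smul, real_inner_smul_left,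
          real_inner_smul_right, hin]
        split_ifs
        · field_simp
          rw [Real.sq_sqrt hB.le]
        · simp) c hε hc
    have h2 := pow_le_pow_left₀ (by positivity) h 2
    rw [div_pow, Real.sq_sqrt hB.le, Real.sq_sqrt hA.le, div_le_iff₀ hA] at h2
    have h3 : B * 1 ≤ B * ((2 + 2 * δ) * ε ^ 2) := by
      nlinarith [mul_le_mul_of_nonneg_left hAB (sq_nonneg ε)]
    exact le_of_mul_le_mul_left h3 hB
  have hlim : 1 ≤ 2 * ε ^ 2 := by
    refine le_of_forall_pos_le_add fun η hη => ?_
    have := key (η / (2 * ε ^ 2)) (by positivity)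
    calc (1 : ℝ) ≤ _ := this
      _ = 2 * ε ^ 2 + η := by field_simp
  refine (sq_le_sq₀ (by positivity) hε.le).1 ?_
  rw [div_pow, Real.sq_sqrt (by norm_num)]
  linarith

/-- For `Ω = ℝ × (0, π) ⊆ ℝ²`, the canonical embedding
`I : W₀^{1,2}(Ω) ↪ L²(Ω)` is maximally noncompact and `β(I) = ‖I‖ = 1/√2`. -/
theorem measure_noncompactness_sobolevEmbedding_strip_two_dim :
    letI : Fact (1 ≤ (2 : ℝ≥0∞)) := ⟨one_le_two⟩
    Filter.Tendsto
        (fun m : ℕ => entropyNumber m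
          (SobolevEmb (2 : ℝ≥0∞) (stripDomain 2 1 (fun _ => 0) (fun _ => Real.pi))))
        Filter.atTop
        (nhds ‖SobolevEmb (2 : ℝ≥0∞) (stripDomain 2 1 (fun _ => 0) (fun _ => Real.pi))‖) ∧
      ‖SobolevEmb (2 : ℝ≥0∞) (stripDomain 2 1 (fun _ => 0) (fun _ => Real.pi))‖ =
        1 / Real.sqrt 2 := by
  have hle := norm_sobolevEmb_strip_le
  have hpos : 0 < 1 / Real.sqrt 2 := by positivity
  have hcover : ∀ {ι : Type} [Nonempty ι] {ε : ℝ},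
      ‖SobolevEmb (2 : ℝ≥0∞) (stripDomain 2 1 (fun _ => 0) (fun _ => Real.pi))‖ ≤ ε →
      ∃ c : ι → Lp ℝ 2 (volume : Measure (Fin 2 → ℝ)),
        ∀ x : W0sub 2 (stripDomain 2 1 (fun _ => 0) (fun _ => Real.pi)), ‖x‖ ≤ 1 →
          ∃ j, ‖SobolevEmb 2 _ x - c j‖ ≤ ε := by
    intro ι _ ε h
    refine ⟨fun _ => 0, fun x hx => ⟨Classical.arbitrary ι, ?_⟩⟩
    rw [sub_zero]
    exact (ContinuousLinearMap.unit_le_opNorm _ x hx).trans h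
  have hnorm : ‖SobolevEmb (2 : ℝ≥0∞) (stripDomain 2 1 (fun _ => 0) (fun _ => Real.pi))‖ =
      1 / Real.sqrt 2 := by
    refine le_antisymm hle (le_of_forall_pos_le_add fun η hη => ?_)
    obtain ⟨c, hc⟩ := hcover (ι := Unit) (le_add_of_nonneg_right hη.le)
    exact one_div_sqrt_two_le_of_finite_cover c (by positivity) hc
  refine ⟨?_, hnorm⟩
  rw [hnorm]
  refine tendsto_const_nhds.congr fun m => ?_
  refine le_antisymm (le_csInf ⟨_, hpos, hcover hle⟩ ?_) (csInf_le ⟨0, fun ε h => h.1.le⟩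
    ⟨hpos, hcover hle⟩)
  rintro ε ⟨hε, c, hc⟩
  exact one_div_sqrt_two_le_of_finite_cover c hε hc
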